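/- Consider the following four 4-dimensional ZMod 3-subspaces of AS_4(ZMod 3), each given as the set of matrices obtained by letting a, b, c, d range over ZMod 3: U₁ = {!![0,0,a,c; 0,0,b,d; −a,−b,0,0; −c,−d,0,0]}, U₂ = {!![0,d,a,c; −d,0,b,0; −a,−b,0,0; −c,0,0,0]}, U₃ = {!![0,d,a,c; −d,0,b,0; −a,−b,0,d; −c,0,−d,0]}, U₄ = {!![0,c,a,d; −c,0,d,b; −a,−d,0,c; −d,−b,−c,0]}. Then every 4-dimensional ZMod 3-subspace of AS_4(ZMod 3) is congruent to exactly one of U₁, U₂, U₃, U₄; in particular U₁, …, U₄ are pairwise non-congruent. -/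

import Mathlib

open Matrix

/-- The four representative 4-dimensional subspaces of antisymmetric `4 × 4` matrices over
`ZMod 3`, given as sets of matrices with `a, b, c, d` ranging over `ZMod 3`. -/
def reps4of4 : Fin 4 → Set (Matrix (Fin 4) (Fin 4) (ZMod 3)) :=
  ![{M | ∃ a b c d : ZMod 3, M = !![0,0,a,c; 0,0,b,d; -a,-b,0,0; -c,-d,0,0]},
    {M | ∃ a b c d : ZMod 3, M = !![0,d,a,c; -d,0,b,0; -a,-b,0,0; -c,0,0,0]},
    {M | ∃ a b c d : ZMod 3, M = !![0,d,a,c; -d,0,b,0; -a,-b,0,d; -c,0,-d,0]},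
    {M | ∃ a b c d : ZMod 3, M = !![0,c,a,d; -c,0,d,b; -a,-d,0,c; -d,-b,-c,0]}]


namespace AS4

/-- `4 × 4` matrices over `ZMod 3`. -/
abbrev Mat := Matrix (Fin 4) (Fin 4) (ZMod 3)

/-- The antisymmetric matrix with given entries above the diagonal. -/
def M (a b c d e f : ZMod 3) : Mat :=
  !![0,a,b,c; -a,0,d,e; -b,-d,0,f; -c,-e,-f,0]

/-- `F` and `G` both annihilate (under the trace form) a congruent copy of a representative. -/
def Good (F G : Mat) : Prop :=
  ∃ i : Fin 4, ∃ Q : Mat, Q.det ≠ 0 ∧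
    ∀ X ∈ reps4of4 i, (F * (Q * X * Qᵀ)).trace = 0 ∧ (G * (Q * X * Qᵀ)).trace = 0

theorem M_of_antisymm {X : Mat} (h : Xᵀ = -X) :
    X = M (X 0 1) (X 0 2) (X 0 3) (X 1 2) (X 1 3) (X 2 3) := by
  have h' : ∀ i j, X j i = - X i j := fun i j => by
    have := congrFun (congrFun h i) j
    simpa using this
  have hd : ∀ x : ZMod 3, x = -x → x = 0 := by decide
  ext i j
  fin_cases i <;> fin_cases j <;> simp [M] <;> first | exact hd _ (h' _ _) | exact h' _ _

theorem M_transpose (a b c d e f : ZMod 3) : (M a b c d e f)ᵀ = - M a b c d e f := by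
  ext i j
  fin_cases i <;> fin_cases j <;> simp [M]

/-- The general formula for the congruence action in coordinates. -/
theorem act_formula (p q r s t u v w p' q' r' s' t' u' v' w' a b c d e f : ZMod 3) :
    (!![p,q,r,s; t,u,v,w; p',q',r',s'; t',u',v',w'] : Mat)ᵀ * M a b c d e f *
      !![p,q,r,s; t,u,v,w; p',q',r',s'; t',u',v',w'] =
    M (a*(p*u-t*q) + b*(p*q'-p'*q) + c*(p*u'-t'*q) + d*(t*q'-p'*u) + e*(t*u'-t'*u)
        + f*(p'*u'-t'*q'))
      (a*(p*v-t*r) + b*(p*r'-p'*r) + c*(p*v'-t'*r) + d*(t*r'-p'*v) + e*(t*v'-t'*v)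
        + f*(p'*v'-t'*r'))
      (a*(p*w-t*s) + b*(p*s'-p'*s) + c*(p*w'-t'*s) + d*(t*s'-p'*w) + e*(t*w'-t'*w)
        + f*(p'*w'-t'*s'))
      (a*(q*v-u*r) + b*(q*r'-q'*r) + c*(q*v'-u'*r) + d*(u*r'-q'*v) + e*(u*v'-u'*v)
        + f*(q'*v'-u'*r'))
      (a*(q*w-u*s) + b*(q*s'-q'*s) + c*(q*w'-u'*s) + d*(u*s'-q'*w) + e*(u*w'-u'*w)
        + f*(q'*w'-u'*s'))
      (a*(r*w-v*s) + b*(r*s'-r'*s) + c*(r*w'-v'*s) + d*(v*s'-r'*w) + e*(v*w'-v'*w)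
        + f*(r'*w'-v'*s')) := by
  ext i j
  fin_cases i <;> fin_cases j <;> simp [M, Matrix.mul_apply, Fin.sum_univ_four] <;> ring

theorem det_formula (p q r s t u v w p' q' r' s' t' u' v' w' : ZMod 3) :
    (!![p,q,r,s; t,u,v,w; p',q',r',s'; t',u',v',w'] : Mat).det =
      (p*u-t*q)*(r'*w'-v'*s') - (p*v-t*r)*(q'*w'-u'*s') + (p*w-t*s)*(q'*v'-u'*r')
      + (q*v-u*r)*(p'*w'-t'*s') - (q*w-u*s)*(p'*v'-t'*r') + (r*w-v*s)*(p'*u'-t'*q') := by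
  simp [Matrix.det_succ_row_zero, Fin.sum_univ_succ, Fin.succAbove]
  ring

theorem M_det (a b c d e f : ZMod 3) : (M a b c d e f).det = (a*f - b*e + c*d)^2 := by
  rw [M, det_formula]; ring

/-! ### Closure properties of `Good` -/

theorem Good.congr {F G P : Mat} (hP : P.det ≠ 0) (h : Good (Pᵀ * F * P) (Pᵀ * G * P)) :
    Good F G := by
  obtain ⟨i, Q, hQ, h⟩ := h
  refine ⟨i, P * Q, by rw [det_mul]; exact mul_ne_zero hP hQ, fun X hX => ?_⟩
  have key : ∀ F : Mat, (F * (P * Q * X * (P * Q)ᵀ)).trace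
      = (Pᵀ * F * P * (Q * X * Qᵀ)).trace := by
    intro F
    rw [transpose_mul, Matrix.mul_assoc Pᵀ, Matrix.mul_assoc Pᵀ, Matrix.trace_mul_comm Pᵀ]
    simp only [Matrix.mul_assoc]
  rw [key, key]
  exact h X hX

theorem Good.swap {F G : Mat} (h : Good F G) : Good G F := by
  obtain ⟨i, Q, hQ, h⟩ := h
  exact ⟨i, Q, hQ, fun X hX => (h X hX).symm⟩

theorem Good.comb {F G : Mat} (x y : ZMod 3) (h : Good F G) : Good F (x • F + y • G) := by
  obtain ⟨i, Q, hQ, h⟩ := h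
  refine ⟨i, Q, hQ, fun X hX => ⟨(h X hX).1, ?_⟩⟩
  rw [Matrix.add_mul, Matrix.trace_add, Matrix.smul_mul, Matrix.smul_mul, Matrix.trace_smul,
    Matrix.trace_smul, (h X hX).1, (h X hX).2]
  simp

theorem Good.zero {F G : Mat} (h : Good F G) : Good F 0 := by
  simpa using h.comb 0 0

theorem comb_M (x y a b c d e f a' b' c' d' e' f' : ZMod 3) :
    x • M a b c d e f + y • M a' b' c' d' e' f' =
      M (x*a+y*a') (x*b+y*b') (x*c+y*c') (x*d+y*d') (x*e+y*e') (x*f+y*f') := by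
  ext i j
  fin_cases i <;> fin_cases j <;> simp [M] <;> ring

/-! ### Base cases -/

theorem base1 : Good (M 1 0 0 0 0 0) (M 0 0 0 0 0 1) := by
  refine ⟨0, 1, by simp, ?_⟩
  rintro X ⟨a, b, c, d, rfl⟩
  constructor <;> simp [M, Matrix.trace, Fin.sum_univ_four]

/-- Turn the trace conditions into a check on upper-triangular coordinates. -/
theorem trace_M (a b c d e f a' b' c' d' e' f' : ZMod 3) :
    (M a b c d e f * M a' b' c' d' e' f').trace = a*a'+b*b'+c*c'+d*d'+e*e'+f*f' := by
  have h3 : (3 : ZMod 3) = 0 := by decide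
  simp [M, Matrix.trace, Fin.sum_univ_four]
  linear_combination (-(a*a'+b*b'+c*c'+d*d'+e*e'+f*f')) * h3

theorem base_aux (i : Fin 4) (Q F G : Mat) (hQ : Q.det ≠ 0)
    (h : ∀ X ∈ reps4of4 i, (Qᵀ * F * Q * X).trace = 0 ∧ (Qᵀ * G * Q * X).trace = 0) :
    Good F G := by
  apply Good.congr hQ
  refine ⟨i, 1, by simp, fun X hX => ?_⟩
  simpa using h X hX

theorem base2 : Good (M 1 0 0 0 0 0) (M 0 1 0 0 0 0) := by
  refine base_aux 1 !![0,0,0,1; 0,1,0,0; 0,0,1,0; 1,0,0,0] _ _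
    (by rw [det_formula]; decide) ?_
  rintro X ⟨a, b, c, d, rfl⟩
  change (_ * M d a c b 0 0).trace = 0 ∧ (_ * M d a c b 0 0).trace = 0
  simp only [act_formula, trace_M]
  revert a b c d
  decide

theorem base3 : Good (M 1 0 0 0 0 0) (M 0 1 0 0 1 0) := by
  refine base_aux 2 !![0,1,0,0; 0,0,0,1; 2,0,0,0; 0,0,1,0] _ _
    (by rw [det_formula]; decide) ?_
  rintro X ⟨a, b, c, d, rfl⟩
  change (_ * M d a c b 0 d).trace = 0 ∧ (_ * M d a c b 0 d).trace = 0
  simp only [act_formula, trace_M]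
  revert a b c d
  decide

theorem base4 : Good (M 1 0 0 0 0 1) (M 0 1 0 0 (-1) 0) := by
  refine base_aux 3 !![0,0,0,1; 0,0,1,0; 1,0,0,0; 0,1,0,0] _ _
    (by rw [det_formula]; decide) ?_
  rintro X ⟨a, b, c, d, rfl⟩
  change (_ * M c a d d b c).trace = 0 ∧ (_ * M c a d d b c).trace = 0
  simp only [act_formula, trace_M]
  revert a b c d
  decide

theorem base5 : Good (M 1 0 0 0 0 1) (M 0 1 0 0 1 1) := by
  refine base_aux 3 !![0,1,0,1; 1,0,1,0; 1,0,0,0; 0,2,0,0] _ _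
    (by rw [det_formula]; decide) ?_
  rintro X ⟨a, b, c, d, rfl⟩
  change (_ * M c a d d b c).trace = 0 ∧ (_ * M c a d d b c).trace = 0
  simp only [act_formula, trace_M]
  revert a b c d
  decide

theorem base6 : Good (M 1 0 0 0 0 1) (M 0 1 0 0 1 (-1)) := by
  refine base_aux 3 !![1,0,1,0; 0,0,0,1; 0,2,0,1; 0,0,1,0] _ _
    (by rw [det_formula]; decide) ?_
  rintro X ⟨a, b, c, d, rfl⟩
  change (_ * M c a d d b c).trace = 0 ∧ (_ * M c a d d b c).trace = 0
  simp only [act_formula, trace_M]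
  revert a b c d
  decide

/-! ### Normal form of a single antisymmetric matrix -/

/-- `F` is congruent to one of the normal forms. -/
def Nrm (F : Mat) : Prop :=
  ∃ P : Mat, P.det ≠ 0 ∧ (Pᵀ * F * P = 0 ∨ Pᵀ * F * P = M 1 0 0 0 0 0 ∨
    Pᵀ * F * P = M 1 0 0 0 0 1)

theorem Nrm.congr {F P : Mat} (hP : P.det ≠ 0) (h : Nrm (Pᵀ * F * P)) : Nrm F := by
  obtain ⟨Q, hQ, h⟩ := h
  refine ⟨P * Q, by rw [det_mul]; exact mul_ne_zero hP hQ, ?_⟩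
  have : (P * Q)ᵀ * F * (P * Q) = Qᵀ * (Pᵀ * F * P) * Q := by
    simp only [transpose_mul, Matrix.mul_assoc]
  rwa [this]

theorem cases3 : ∀ x : ZMod 3, x = 0 ∨ x = 1 ∨ x = -1 := by decide

theorem nrm_one (b c d e f : ZMod 3) : Nrm (M 1 b c d e f) := by
  refine Nrm.congr (P := !![1,0,d,e; 0,1,-b,-c; 0,0,1,0; 0,0,0,1])
    (by rw [det_formula]; ring_nf; decide) ?_
  rw [act_formula]
  have : ∀ x, Nrm (M 1 0 0 0 0 x) := by
    intro x
    rcases cases3 x with rfl | rfl | rfl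
    · exact ⟨1, by simp, by simp⟩
    · exact ⟨1, by simp, by simp⟩
    · refine ⟨!![1,0,0,0; 0,1,0,0; 0,0,-1,0; 0,0,0,1], by rw [det_formula]; decide, ?_⟩
      rw [act_formula]
      right; right
      norm_num
  convert this (f - b * e + c * d) using 2 <;> ring

theorem nrm_ne {a : ZMod 3} (ha : a ≠ 0) (b c d e f : ZMod 3) : Nrm (M a b c d e f) := by
  rcases cases3 a with rfl | rfl | rfl
  · exact absurd rfl ha
  · exact nrm_one ..
  · refine Nrm.congr (P := !![-1,0,0,0; 0,1,0,0; 0,0,1,0; 0,0,0,1])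
      (by rw [det_formula]; decide) ?_
    rw [act_formula]
    convert nrm_one (-b) (-c) d e f using 2 <;> ring

theorem nrm_all (a b c d e f : ZMod 3) : Nrm (M a b c d e f) := by
  by_cases ha : a ≠ 0
  · exact nrm_ne ha ..
  by_cases hb : b ≠ 0
  · refine Nrm.congr (P := !![1,0,0,0; 0,0,1,0; 0,1,0,0; 0,0,0,1])
      (by rw [det_formula]; decide) ?_
    rw [act_formula]
    apply nrm_ne
    ring_nf; simpa using hb
  by_cases hc : c ≠ 0
  · refine Nrm.congr (P := !![1,0,0,0; 0,0,0,1; 0,0,1,0; 0,1,0,0])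
      (by rw [det_formula]; decide) ?_
    rw [act_formula]
    apply nrm_ne
    ring_nf; simpa using hc
  by_cases hd : d ≠ 0
  · refine Nrm.congr (P := !![0,0,1,0; 1,0,0,0; 0,1,0,0; 0,0,0,1])
      (by rw [det_formula]; decide) ?_
    rw [act_formula]
    apply nrm_ne
    ring_nf; simpa using hd
  by_cases he : e ≠ 0
  · refine Nrm.congr (P := !![0,0,1,0; 1,0,0,0; 0,0,0,1; 0,1,0,0])
      (by rw [det_formula]; decide) ?_
    rw [act_formula]
    apply nrm_ne
    ring_nf; simpa using he
  by_cases hf : f ≠ 0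
  · refine Nrm.congr (P := !![0,0,1,0; 0,0,0,1; 1,0,0,0; 0,1,0,0])
      (by rw [det_formula]; decide) ?_
    rw [act_formula]
    apply nrm_ne
    ring_nf; simpa using hf
  push Not at ha hb hc hd he hf
  subst ha hb hc hd he hf
  refine ⟨1, by simp, Or.inl ?_⟩
  ext i j
  fin_cases i <;> fin_cases j <;> simp [M]

/-! ### Pencils through a degenerate form -/

theorem J1_reduce {a b c d e f : ZMod 3} (a' : ZMod 3)
    (h : Good (M 1 0 0 0 0 0) (M a b c d e f)) :
    Good (M 1 0 0 0 0 0) (M a' b c d e f) := by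
  have := h.comb (a' - a) 1
  rw [comb_M] at this
  convert this using 2 <;> ring

theorem J1_neg {b c d e f : ZMod 3}
    (h : Good (M 1 0 0 0 0 0) (M 0 (-b) (-c) (-d) (-e) (-f))) (a : ZMod 3) :
    Good (M 1 0 0 0 0 0) (M a b c d e f) := by
  have := h.comb a (-1)
  rw [comb_M] at this
  convert this using 2 <;> ring

theorem J1_one (a b c d e : ZMod 3) : Good (M 1 0 0 0 0 0) (M a b c d e 1) := by
  refine Good.congr (P := !![1,0,0,0; 0,1,0,0; -c,-e,1,0; b,d,0,1])
    (by rw [det_formula]; ring_nf; decide) ?_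
  rw [act_formula, act_formula]
  convert J1_reduce (a - b * e + c * d) base1 using 2 <;> ring

theorem J1_rank_one (a c d : ZMod 3) : Good (M 1 0 0 0 0 0) (M a 1 c d (c * d) 0) := by
  refine Good.congr (P := !![1,-d,0,0; 0,1,0,0; 0,0,1,-c; 0,0,0,1])
    (by rw [det_formula]; ring_nf; decide) ?_
  rw [act_formula, act_formula]
  convert J1_reduce a base2 using 2 <;> ring

theorem J1_rank_two {b c d e : ZMod 3} (h : b * e - c * d ≠ 0) (a : ZMod 3) :
    Good (M 1 0 0 0 0 0) (M a b c d e 0) := by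
  have hs : (b * e - c * d) ^ 2 = 1 := by
    generalize b * e - c * d = n at h
    revert n; decide
  refine Good.congr (P := !![1,0,0,0; 0,1,0,0;
      0,0,(b * e - c * d) * e,-((b * e - c * d) * c); 0,0,-((b * e - c * d) * d),(b * e - c * d) * b])
    ?_ ?_
  · rw [det_formula]
    have : b * e - c * d ≠ 0 := h
    convert pow_ne_zero 3 h using 1
    ring
  rw [act_formula, act_formula]
  convert J1_reduce a base3 using 2 <;> first | ring1 | linear_combination hs

theorem J1_det_zero {b c d e : ZMod 3} (h : b * e - c * d = 0) (hb : b ≠ 0) (a : ZMod 3) :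
    Good (M 1 0 0 0 0 0) (M a b c d e 0) := by
  rcases cases3 b with rfl | rfl | rfl
  · exact absurd rfl hb
  · convert J1_rank_one a c d using 2
    linear_combination h
  · apply J1_neg
    convert J1_rank_one 0 (-c) (-d) using 2
    · ring
    · linear_combination h
    · ring

theorem M_zero : M 0 0 0 0 0 0 = 0 := by
  ext i j
  fin_cases i <;> fin_cases j <;> simp [M]

theorem J1_all (a b c d e f : ZMod 3) : Good (M 1 0 0 0 0 0) (M a b c d e f) := by
  rcases cases3 f with rfl | rfl | rfl
  rotate_left
  · exact J1_one ..
  · apply J1_neg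
    convert J1_one 0 (-b) (-c) (-d) (-e) using 2
    ring
  by_cases h : b * e - c * d = 0
  swap
  · exact J1_rank_two h a
  by_cases hb : b ≠ 0
  · exact J1_det_zero h hb a
  by_cases hc : c ≠ 0
  · refine Good.congr (P := !![1,0,0,0; 0,1,0,0; 0,0,0,1; 0,0,1,0])
      (by rw [det_formula]; decide) ?_
    rw [act_formula, act_formula]
    convert J1_det_zero (b := c) (c := b) (d := e) (e := d) (by linear_combination -h) hc a
      using 2 <;> ring
  by_cases hd : d ≠ 0
  · refine Good.congr (P := !![0,-1,0,0; 1,0,0,0; 0,0,1,0; 0,0,0,1])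
      (by rw [det_formula]; decide) ?_
    rw [act_formula, act_formula]
    convert J1_det_zero (b := d) (c := e) (d := -b) (e := -c) (by linear_combination h) hd a
      using 2 <;> ring
  by_cases he : e ≠ 0
  · refine Good.congr (P := !![0,-1,0,0; 1,0,0,0; 0,0,0,1; 0,0,1,0])
      (by rw [det_formula]; decide) ?_
    rw [act_formula, act_formula]
    convert J1_det_zero (b := e) (c := d) (d := -c) (e := -b) (by linear_combination -h) he a
      using 2 <;> ring
  push Not at hb hc hd he
  subst hb hc hd he
  apply J1_reduce (a := 0)
  rw [M_zero]
  exact base2.zero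

/-- The pencil contains a degenerate form. -/
theorem good_of_degenerate (a b c d e f : ZMod 3) (h : a * f - b * e + c * d = 0) {G : Mat}
    (hG : Gᵀ = -G) : Good (M a b c d e f) G := by
  obtain ⟨P, hP, hF⟩ := nrm_all a b c d e f
  apply Good.congr hP
  have hG' : (Pᵀ * G * P)ᵀ = -(Pᵀ * G * P) := by
    simp [transpose_mul, hG, Matrix.mul_assoc]
  rw [M_of_antisymm hG']
  rcases hF with hF | hF | hF
  · rw [hF]
    exact (J1_all _ _ _ _ _ _).swap.zero.swap
  · rw [hF]
    exact J1_all ..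
  · exfalso
    have := congrArg Matrix.det hF
    rw [det_mul, det_mul, M_det, M_det, h] at this
    revert this
    norm_num

/-! ### Pencils through the nondegenerate form -/

theorem J2_zero (b c d e f : ZMod 3) : Good (M 1 0 0 0 0 1) (M 0 b c d e f) := by
  by_cases hx : ∃ x : ZMod 3, x * (f + x) - b * e + c * d = 0
  · obtain ⟨x, hx⟩ := hx
    have h := (good_of_degenerate x b c d e (f + x) hx (M_transpose 1 0 0 0 0 1)).swap
    have := h.comb (-x) 1
    rw [comb_M] at this
    convert this using 2 <;> ring
  push Not at hx
  have key : ∀ f n : ZMod 3, (∀ x, x * (f + x) - n ≠ 0) →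
      (n = -1 ∧ f = 0) ∨ (n = 1 ∧ f = 1) ∨ (n = 1 ∧ f = -1) := by decide
  rcases key f (b * e - c * d) (fun x h => hx x (by linear_combination h)) with
    ⟨hn, rfl⟩ | ⟨hn, rfl⟩ | ⟨hn, rfl⟩
  · refine Good.congr (P := !![1,0,0,0; 0,1,0,0; 0,0,-e,-c; 0,0,d,b]) ?_ ?_
    · rw [det_formula]
      have : c * d - e * b ≠ 0 := by
        rw [show c * d - e * b = 1 by linear_combination -hn]; decide
      convert this using 1
      ring
    rw [act_formula, act_formula]
    convert base4 using 2 <;> first | ring1 | linear_combination hn | linear_combination -hn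
  · refine Good.congr (P := !![1,0,0,0; 0,1,0,0; 0,0,e,-c; 0,0,-d,b]) ?_ ?_
    · rw [det_formula]
      have : b * e - c * d ≠ 0 := by
        rw [hn]; decide
      convert this using 1
      ring
    rw [act_formula, act_formula]
    convert base5 using 2 <;> first | ring1 | linear_combination hn | linear_combination -hn
  · refine Good.congr (P := !![1,0,0,0; 0,1,0,0; 0,0,e,-c; 0,0,-d,b]) ?_ ?_
    · rw [det_formula]
      have : b * e - c * d ≠ 0 := by
        rw [hn]; decide
      convert this using 1
      ring
    rw [act_formula, act_formula]
    convert base6 using 2 <;> first | ring1 | linear_combination hn | linear_combination -hn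

theorem J2_all (a b c d e f : ZMod 3) : Good (M 1 0 0 0 0 1) (M a b c d e f) := by
  have := (J2_zero b c d e (f - a)).comb a 1
  rw [comb_M] at this
  convert this using 2 <;> ring

theorem good_all {F G : Mat} (hF : Fᵀ = -F) (hG : Gᵀ = -G) : Good F G := by
  rw [M_of_antisymm hF]
  obtain ⟨P, hP, hF⟩ := nrm_all (F 0 1) (F 0 2) (F 0 3) (F 1 2) (F 1 3) (F 2 3)
  apply Good.congr hP
  have hG' : (Pᵀ * G * P)ᵀ = -(Pᵀ * G * P) := by
    simp [transpose_mul, hG, Matrix.mul_assoc]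
  rw [M_of_antisymm hG']
  rcases hF with hF | hF | hF
  · rw [hF]
    exact (J1_all _ _ _ _ _ _).swap.zero.swap
  · rw [hF]
    exact J1_all ..
  · rw [hF]
    exact J2_all ..

/-! ### The representatives: cardinalities and invariants -/

/-- Parametrizations of the four representatives. -/
def par : Fin 4 → (ZMod 3 × ZMod 3 × ZMod 3 × ZMod 3) → Mat :=
  ![fun v => M 0 v.1 v.2.2.1 v.2.1 v.2.2.2 0,
    fun v => M v.2.2.2 v.1 v.2.2.1 v.2.1 0 0,
    fun v => M v.2.2.2 v.1 v.2.2.1 v.2.1 0 v.2.2.2,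
    fun v => M v.2.2.1 v.1 v.2.2.2 v.2.2.2 v.2.1 v.2.2.1]

theorem reps_eq_range (i : Fin 4) : reps4of4 i = Set.range (par i) := by
  ext X
  fin_cases i <;>
  · constructor
    · rintro ⟨a, b, c, d, rfl⟩
      refine ⟨(a, b, c, d), ?_⟩
      simp [par, M]
    · rintro ⟨⟨a, b, c, d⟩, rfl⟩
      refine ⟨a, b, c, d, ?_⟩
      simp [par, M]

theorem M_inj {a b c d e f a' b' c' d' e' f' : ZMod 3}
    (h : M a b c d e f = M a' b' c' d' e' f') :
    a = a' ∧ b = b' ∧ c = c' ∧ d = d' ∧ e = e' ∧ f = f' :=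
  ⟨congrFun (congrFun h 0) 1, congrFun (congrFun h 0) 2, congrFun (congrFun h 0) 3,
    congrFun (congrFun h 1) 2, congrFun (congrFun h 1) 3, congrFun (congrFun h 2) 3⟩

theorem par_injective (i : Fin 4) : Function.Injective (par i) := by
  rintro ⟨a, b, c, d⟩ ⟨a', b', c', d'⟩ h
  fin_cases i <;>
  · obtain ⟨h1, h2, h3, h4, h5, h6⟩ := M_inj h
    simp_all

theorem reps_ncard (i : Fin 4) : (reps4of4 i).ncard = 81 := by
  rw [reps_eq_range, ← Set.image_univ, Set.ncard_image_of_injective _ (par_injective i),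
    Set.ncard_univ, Nat.card_eq_fintype_card]
  simp [ZMod.card]

theorem reps_antisymm (i : Fin 4) {X : Mat} (hX : X ∈ reps4of4 i) : Xᵀ = -X := by
  rw [reps_eq_range] at hX
  obtain ⟨v, rfl⟩ := hX
  fin_cases i <;> exact M_transpose ..

/-- The Pfaffians of the four parametrizations. -/
def pf : Fin 4 → (ZMod 3 × ZMod 3 × ZMod 3 × ZMod 3) → ZMod 3 :=
  ![fun v => v.2.2.1 * v.2.1 - v.1 * v.2.2.2,
    fun v => v.2.2.1 * v.2.1,
    fun v => v.2.2.2 * v.2.2.2 + v.2.2.1 * v.2.1,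
    fun v => v.2.2.1 * v.2.2.1 - v.1 * v.2.1 + v.2.2.2 * v.2.2.2]

theorem par_det (i : Fin 4) (v) : (par i v).det = pf i v ^ 2 := by
  fin_cases i <;> refine (M_det ..).trans ?_ <;> simp [pf] <;> ring

/-- Number of degenerate elements. -/
noncomputable def ndeg (S : Set Mat) : ℕ := {X ∈ S | X.det = 0}.ncard

theorem ndeg_reps (i : Fin 4) : ndeg (reps4of4 i) = ![33, 45, 27, 21] i := by
  have h1 : {X ∈ reps4of4 i | X.det = 0} =
      par i '' ((Finset.univ.filter fun v => pf i v = 0 : Finset _) : Set _) := by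
    ext X
    rw [reps_eq_range]
    constructor
    · rintro ⟨⟨v, rfl⟩, h⟩
      rw [par_det] at h
      exact ⟨v, by simpa using h, rfl⟩
    · rintro ⟨v, hv, rfl⟩
      refine ⟨⟨v, rfl⟩, ?_⟩
      rw [par_det]
      simpa using hv
  rw [ndeg, h1, Set.ncard_image_of_injective _ (par_injective i), Set.ncard_coe_finset]
  clear h1
  revert i
  decide +kernel

theorem congr_injective {P : Mat} (hP : IsUnit P) :
    Function.Injective (fun X : Mat => P * X * Pᵀ) := by
  have hPt : IsUnit Pᵀ := by
    rw [Matrix.isUnit_iff_isUnit_det] at hP ⊢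
    rwa [Matrix.det_transpose]
  intro X Y h
  exact hP.mul_left_cancel (hPt.mul_right_cancel h)

theorem ndeg_congr {P : Mat} (hP : IsUnit P) (S : Set Mat) :
    ndeg ((fun X : Mat => P * X * Pᵀ) '' S) = ndeg S := by
  have hd : P.det ≠ 0 := ((Matrix.isUnit_iff_isUnit_det _).1 hP).ne_zero
  have : {X ∈ (fun X : Mat => P * X * Pᵀ) '' S | X.det = 0} =
      (fun X : Mat => P * X * Pᵀ) '' {X ∈ S | X.det = 0} := by
    ext Y
    constructor
    · rintro ⟨⟨X, hX, rfl⟩, h⟩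
      refine ⟨X, ⟨hX, ?_⟩, rfl⟩
      simpa [det_mul, hd] using h
    · rintro ⟨X, ⟨hX, h⟩, rfl⟩
      refine ⟨⟨X, hX, rfl⟩, ?_⟩
      simp [det_mul, h]
  rw [ndeg, this, Set.ncard_image_of_injective _ (congr_injective hP), ndeg]

theorem ndeg_inj {i j : Fin 4} (h : ndeg (reps4of4 i) = ndeg (reps4of4 j)) : i = j := by
  rw [ndeg_reps, ndeg_reps] at h
  revert i j
  decide

/-! ### Every subspace is cut out by two forms -/

/-- Coordinates on antisymmetric matrices. -/
def T : (Fin 6 → ZMod 3) →ₗ[ZMod 3] Mat where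
  toFun x := M (x 0) (x 1) (x 2) (x 3) (x 4) (x 5)
  map_add' x y := by
    ext i j
    fin_cases i <;> fin_cases j <;> simp [M] <;> ring
  map_smul' r x := by
    ext i j
    fin_cases i <;> fin_cases j <;> simp [M]

theorem T_injective : Function.Injective T := by
  intro x y h
  obtain ⟨h1, h2, h3, h4, h5, h6⟩ := M_inj h
  ext i
  fin_cases i <;> assumption

theorem mem_range_T {X : Mat} (h : Xᵀ = -X) : X ∈ LinearMap.range T :=
  ⟨![X 0 1, X 0 2, X 0 3, X 1 2, X 1 3, X 2 3], (M_of_antisymm h).symm⟩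

theorem exists_forms (V : Submodule (ZMod 3) Mat) (hV : ∀ X ∈ V, Xᵀ = -X)
    (h4 : Module.finrank (ZMod 3) V = 4) :
    ∃ F G : Mat, Fᵀ = -F ∧ Gᵀ = -G ∧
      ∀ X : Mat, Xᵀ = -X → (F * X).trace = 0 → (G * X).trace = 0 → X ∈ V := by
  let V' := V.comap T
  have hmap : V'.map T = V := by
    rw [Submodule.map_comap_eq, inf_eq_right]
    exact fun X hX => mem_range_T (hV X hX)
  have hV' : Module.finrank (ZMod 3) V' = 4 := by
    rw [← h4, ← hmap]
    exact (Submodule.equivMapOfInjective T T_injective V').finrank_eq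
  have hW : Module.finrank (ZMod 3) V'.dualAnnihilator = 2 := by
    have := Subspace.finrank_add_finrank_dualAnnihilator_eq V'
    rw [hV'] at this
    simp at this
    omega
  let B := Module.finBasisOfFinrankEq (ZMod 3) V'.dualAnnihilator hW
  let form : Module.Dual (ZMod 3) (Fin 6 → ZMod 3) → Mat := fun φ =>
    T (fun i => φ (Pi.single i 1))
  have hform : ∀ φ x, (form φ * T x).trace = φ x := by
    intro φ x
    refine (trace_M ..).trans ?_
    have hx : x = ∑ i, x i • (Pi.single i 1 : Fin 6 → ZMod 3) := pi_eq_sum_univ' x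
    conv_rhs => rw [hx, map_sum]
    simp only [map_smul, smul_eq_mul, Fin.sum_univ_six]
    ring
  refine ⟨form (B 0), form (B 1), M_transpose .., M_transpose .., fun X hX h0 h1 => ?_⟩
  obtain ⟨x, rfl⟩ := mem_range_T hX
  rw [hform] at h0 h1
  change x ∈ V'
  rw [← Subspace.forall_mem_dualAnnihilator_apply_eq_zero_iff]
  intro φ hφ
  have := B.sum_repr ⟨φ, hφ⟩
  have := congrArg Subtype.val this
  simp only [Fin.sum_univ_two] at this
  change _ = φ at this
  rw [← this]
  simp [h0, h1]

theorem exists_congr (V : Submodule (ZMod 3) Mat) (hV : ∀ X ∈ V, Xᵀ = -X)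
    (h4 : Module.finrank (ZMod 3) V = 4) :
    ∃ i : Fin 4, ∃ P : GL (Fin 4) (ZMod 3),
      reps4of4 i = (fun X : Mat => (P : Mat) * X * (P : Mat)ᵀ) '' (V : Set Mat) := by
  obtain ⟨F, G, hF, hG, hFG⟩ := exists_forms V hV h4
  obtain ⟨i, Q, hQ, h⟩ := good_all hF hG
  have hQu : IsUnit Q := (Matrix.isUnit_iff_isUnit_det _).2 hQ.isUnit
  have hsub : (fun X : Mat => Q * X * Qᵀ) '' reps4of4 i ⊆ (V : Set Mat) := by
    rintro _ ⟨X, hX, rfl⟩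
    refine hFG _ ?_ (h X hX).1 (h X hX).2
    simp [transpose_mul, reps_antisymm i hX, Matrix.mul_assoc]
  have hcard : (V : Set Mat).ncard = 81 := by
    have : Nat.card V = 81 := by
      rw [Module.natCard_eq_pow_finrank (K := ZMod 3), h4]
      simp
    exact this
  have heq := Set.eq_of_subset_of_ncard_le hsub (by
    rw [Set.ncard_image_of_injective _ (congr_injective hQu), reps_ncard, hcard])
    (Set.toFinite _)
  obtain ⟨q, rfl⟩ := hQu
  refine ⟨i, q⁻¹, ?_⟩
  rw [← heq, Set.image_image]
  have h1 : ((q⁻¹ : GL (Fin 4) (ZMod 3)) : Mat) * (q : Mat) = 1 := by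
    exact Units.inv_mul q
  have h2 : (q : Mat)ᵀ * ((q⁻¹ : GL (Fin 4) (ZMod 3)) : Mat)ᵀ = 1 := by
    rw [← transpose_mul, h1, transpose_one]
  have h3 : ∀ X : Mat, ((q⁻¹ : GL (Fin 4) (ZMod 3)) : Mat) * ((q : Mat) * X * (q : Mat)ᵀ) *
      ((q⁻¹ : GL (Fin 4) (ZMod 3)) : Mat)ᵀ = X := by
    intro X
    rw [← Matrix.mul_assoc, ← Matrix.mul_assoc, h1, Matrix.one_mul, Matrix.mul_assoc, h2,
      Matrix.mul_one]
  simp only [h3, Set.image_id']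

end AS4

/-- Every 4-dimensional `ZMod 3`-subspace of the antisymmetric `4 × 4` matrices over `ZMod 3`
is congruent to exactly one of the four representatives `reps4of4`; in particular the
representatives are pairwise non-congruent. -/
theorem four_dim_subspaces_of_AS4_classification :
    (∀ V : Submodule (ZMod 3) (Matrix (Fin 4) (Fin 4) (ZMod 3)),
      (∀ X ∈ V, Xᵀ = -X) → Module.finrank (ZMod 3) V = 4 →
      ∃! i : Fin 4, ∃ P : GL (Fin 4) (ZMod 3),
        reps4of4 i =
          (fun X => (P : Matrix (Fin 4) (Fin 4) (ZMod 3)) * X *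
            (P : Matrix (Fin 4) (Fin 4) (ZMod 3))ᵀ) ''
            (V : Set (Matrix (Fin 4) (Fin 4) (ZMod 3)))) ∧
    (∀ i j : Fin 4, i ≠ j →
      ¬ ∃ P : GL (Fin 4) (ZMod 3),
        reps4of4 j =
          (fun X => (P : Matrix (Fin 4) (Fin 4) (ZMod 3)) * X *
            (P : Matrix (Fin 4) (Fin 4) (ZMod 3))ᵀ) '' reps4of4 i) := by
  refine ⟨fun V hV h4 => ?_, ?_⟩
  · obtain ⟨i, P, hP⟩ := AS4.exists_congr V hV h4
    refine ⟨i, ⟨P, hP⟩, ?_⟩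
    rintro j ⟨P', hP'⟩
    apply AS4.ndeg_inj
    rw [hP, hP', AS4.ndeg_congr P.isUnit, AS4.ndeg_congr P'.isUnit]
  · rintro i j hij ⟨P, hP⟩
    apply hij
    apply AS4.ndeg_inj
    rw [hP, AS4.ndeg_congr P.isUnit]
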